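/- arXiv:2109.01530 — 2 statements merged into one kernel-verified Lean document; each statement's English description precedes it below -/
import Mathlib

section
/- Every non-consecutive Latin square of order 5 is also a toroidal non-consecutive Latin square (i.e., additionally, the first and last entries of every row and of every column do not differ by 1) and a modular non-consecutive Latin square (i.e., adjacent cells also never contain the pair {1,5}). -/
/-- An `n × n` Latin square with entries in `{1, …, n}`. -/
def latin (n : ℕ) (M : Fin n → Fin n → ℕ) : Prop :=
  (∀ i j, M i j ∈ Finset.Icc 1 n) ∧
  (∀ i, Function.Injective fun j => M i j) ∧
  (∀ j, Function.Injective fun i => M i j)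

/-- Two cells are orthogonally adjacent. -/
def orthAdj (n : ℕ) (p q : Fin n × Fin n) : Prop :=
  (p.1 = q.1 ∧ (p.2.val + 1 = q.2.val ∨ q.2.val + 1 = p.2.val)) ∨
  (p.2 = q.2 ∧ (p.1.val + 1 = q.1.val ∨ q.1.val + 1 = p.1.val))

/-- Two cells are a king's move apart (orthogonally or diagonally adjacent). -/
def kingAdj (n : ℕ) (p q : Fin n × Fin n) : Prop :=
  p ≠ q ∧ ((p.1.val : ℤ) - q.1.val).natAbs ≤ 1 ∧ ((p.2.val : ℤ) - q.2.val).natAbs ≤ 1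

/-- Two cells are a knight's move apart. -/
def knightAdj (n : ℕ) (p q : Fin n × Fin n) : Prop :=
  (((p.1.val : ℤ) - q.1.val).natAbs = 1 ∧ ((p.2.val : ℤ) - q.2.val).natAbs = 2) ∨
  (((p.1.val : ℤ) - q.1.val).natAbs = 2 ∧ ((p.2.val : ℤ) - q.2.val).natAbs = 1)

/-- Two cells are a bishop's move apart: on a common diagonal, at nonzero distance. -/
def bishopMove (n : ℕ) (p q : Fin n × Fin n) : Prop :=
  ((p.1.val : ℤ) - q.1.val).natAbs = ((p.2.val : ℤ) - q.2.val).natAbs ∧ p.1 ≠ q.1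

/-- Two cells are orthogonally adjacent on the torus (wrapping around). -/
def torAdj (n : ℕ) (p q : Fin n × Fin n) : Prop :=
  p ≠ q ∧
    ((p.1 = q.1 ∧ ((p.2.val + 1) % n = q.2.val ∨ (q.2.val + 1) % n = p.2.val)) ∨
     (p.2 = q.2 ∧ ((p.1.val + 1) % n = q.1.val ∨ (q.1.val + 1) % n = p.1.val)))

/-- Two values differ by exactly 1. -/
def diffOne (a b : ℕ) : Prop := ((a : ℤ) - (b : ℤ)).natAbs = 1

def s4R : List (Fin 5 → ℕ) :=
  [![1,3,5,2,4], ![1,4,2,5,3], ![2,4,1,3,5], ![2,4,1,5,3], ![2,5,3,1,4], ![3,1,4,2,5],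
   ![3,1,5,2,4], ![3,5,1,4,2], ![3,5,2,4,1], ![4,1,3,5,2], ![4,2,5,1,3], ![4,2,5,3,1],
   ![5,2,4,1,3], ![5,3,1,4,2]]

def s4D (r s : Fin 5 → ℕ) : Prop := ∀ j, r j ≠ s j
def s4N (a b : ℕ) : Prop := a + 1 ≠ b ∧ b + 1 ≠ a
def s4V (r s : Fin 5 → ℕ) : Prop := ∀ j, r j ≠ s j ∧ s4N (r j) (s j)

instance : DecidableRel s4D := fun r s => by unfold s4D; infer_instance
instance : DecidableRel s4N := fun r s => by unfold s4N; infer_instance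
instance : DecidableRel s4V := fun r s => by unfold s4V; infer_instance
instance (n : ℕ) : DecidableRel (torAdj n) := fun r s => by unfold torAdj; infer_instance
instance (n : ℕ) : DecidableRel (orthAdj n) := fun r s => by unfold orthAdj; infer_instance

def s4G (N : Fin 5 → Fin 5 → ℕ) : Prop :=
  ∀ p q : Fin 5 × Fin 5, (torAdj 5 p q → s4N (N p.1 p.2) (N q.1 q.2)) ∧
    (orthAdj 5 p q → ¬ (N p.1 p.2 = 1 ∧ N q.1 q.2 = 5))

instance : DecidablePred s4G := fun r => by unfold s4G; infer_instance

theorem s4row : ∀ a ∈ [1,2,3,4,5], ∀ b ∈ [1,2,3,4,5], (a ≠ b ∧ s4N a b) →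
    ∀ c ∈ [1,2,3,4,5], (a ≠ c ∧ b ≠ c ∧ s4N b c) →
    ∀ d ∈ [1,2,3,4,5], (a ≠ d ∧ b ≠ d ∧ c ≠ d ∧ s4N c d) →
    ∀ e ∈ [1,2,3,4,5], (a ≠ e ∧ b ≠ e ∧ c ≠ e ∧ d ≠ e ∧ s4N d e) →
    ![a,b,c,d,e] ∈ s4R := by decide +kernel

theorem s4search : ∀ r0 ∈ s4R, ∀ r1 ∈ s4R, s4V r0 r1 →
    ∀ r2 ∈ s4R, s4V r1 r2 → s4D r0 r2 →
    ∀ r3 ∈ s4R, s4V r2 r3 → s4D r0 r3 → s4D r1 r3 →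
    ∀ r4 ∈ s4R, s4V r3 r4 → s4D r0 r4 → s4D r1 r4 → s4D r2 r4 →
    s4G ![r0,r1,r2,r3,r4] := by decide +kernel

theorem s4N_iff (a b : ℕ) : s4N a b ↔ ¬ diffOne a b := by
  unfold s4N diffOne; omega

/-- Every non-consecutive Latin square of order 5 is also toroidal non-consecutive and
modular non-consecutive (adjacent cells never contain the pair {1,5}). -/
theorem stmt4 (M : Fin 5 → Fin 5 → ℕ) (hL : latin 5 M)
    (hNC : ∀ p q : Fin 5 × Fin 5, orthAdj 5 p q → ¬ diffOne (M p.1 p.2) (M q.1 q.2)) :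
    (∀ p q : Fin 5 × Fin 5, torAdj 5 p q → ¬ diffOne (M p.1 p.2) (M q.1 q.2)) ∧
    (∀ p q : Fin 5 × Fin 5, orthAdj 5 p q → ¬ (M p.1 p.2 = 1 ∧ M q.1 q.2 = 5)) := by
  obtain ⟨hr, hi, hj⟩ := hL
  have hm : ∀ i j, M i j ∈ [1,2,3,4,5] := fun i j => by
    have := Finset.mem_Icc.1 (hr i j)
    simp only [List.mem_cons, List.not_mem_nil, or_false]
    omega
  have ne : ∀ i j k, j ≠ k → M i j ≠ M i k := fun i j k h e => h (hi i e)
  have nd : ∀ i k, i ≠ k → s4D (M i) (M k) := fun i k h j e => h (hj j e)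
  have hrow : ∀ i (j k : Fin 5), j.val + 1 = k.val → s4N (M i j) (M i k) := fun i j k h =>
    (s4N_iff _ _).2 (hNC (i, j) (i, k) (Or.inl ⟨rfl, Or.inl h⟩))
  have hcol : ∀ (i k : Fin 5), i.val + 1 = k.val → s4V (M i) (M k) := fun i k h j =>
    ⟨nd i k (by rintro rfl; omega) j,
    (s4N_iff _ _).2 (hNC (i, j) (k, j) (Or.inr ⟨rfl, Or.inl h⟩))⟩
  have mem : ∀ i, M i ∈ s4R := fun i => by
    have h := s4row (M i 0) (hm _ _)
      (M i 1) (hm _ _) ⟨ne _ _ _ (by decide), hrow _ _ _ rfl⟩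
      (M i 2) (hm _ _) ⟨ne _ _ _ (by decide), ne _ _ _ (by decide), hrow _ _ _ rfl⟩
      (M i 3) (hm _ _) ⟨ne _ _ _ (by decide), ne _ _ _ (by decide), ne _ _ _ (by decide), hrow _ _ _ rfl⟩
      (M i 4) (hm _ _) ⟨ne _ _ _ (by decide), ne _ _ _ (by decide), ne _ _ _ (by decide), ne _ _ _ (by decide), hrow _ _ _ rfl⟩
    have e : M i = ![M i 0, M i 1, M i 2, M i 3, M i 4] := by
      ext j; fin_cases j <;> rfl
    rw [e]; exact h
  have g := s4search (M 0) (mem _) (M 1) (mem _) (hcol _ _ rfl)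
    (M 2) (mem _) (hcol _ _ rfl) (nd _ _ (by decide))
    (M 3) (mem _) (hcol _ _ rfl) (nd _ _ (by decide)) (nd _ _ (by decide))
    (M 4) (mem _) (hcol _ _ rfl) (nd _ _ (by decide)) (nd _ _ (by decide)) (nd _ _ (by decide))
  have e : ![M 0, M 1, M 2, M 3, M 4] = M := by
    ext i j; fin_cases i <;> rfl
  rw [e] at g
  exact ⟨fun p q h => (s4N_iff _ _).1 ((g p q).1 h), fun p q h => (g p q).2 h⟩
end

section
/- There are exactly 4 anti-knight Latin squares of order 4 whose first row is 1,2,3,4; consequently, there are 96 anti-knight Latin squares of order 4. -/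
/-- The four normalized squares. -/
def sqT (k : Fin 4) : Fin 4 → Fin 4 → Fin 4 :=
  ![![![0,1,2,3], ![1,0,3,2], ![2,3,0,1], ![3,2,1,0]],
    ![![0,1,2,3], ![1,2,3,0], ![2,3,0,1], ![3,0,1,2]],
    ![![0,1,2,3], ![3,0,1,2], ![2,3,0,1], ![1,2,3,0]],
    ![![0,1,2,3], ![3,2,1,0], ![2,3,0,1], ![1,0,3,2]]] k

instance (n : ℕ) (p q : Fin n × Fin n) : Decidable (knightAdj n p q) := by
  unfold knightAdj; infer_instance

lemma sqT_row : ∀ k i j j', sqT k i j = sqT k i j' → j = j' := by decide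

lemma sqT_col : ∀ k j i i', sqT k i j = sqT k i' j → i = i' := by decide

set_option maxRecDepth 100000 in
lemma sqT_knight : ∀ k i j i' j', knightAdj 4 (i, j) (i', j') → sqT k i j ≠ sqT k i' j' := by
  decide +kernel

lemma sqT_zero : ∀ k j, sqT k 0 j = j := by decide

lemma sqT_inj : ∀ k k', sqT k 1 0 = sqT k' 1 0 → sqT k 1 1 = sqT k' 1 1 → k = k' := by decide

lemma row2_aux : ∀ a b c d : Fin 4, a ≠ 0 → a ≠ 1 → b ≠ 0 → b ≠ 1 → b ≠ 2 →
    c ≠ 1 → c ≠ 2 → c ≠ 3 → d ≠ 2 → d ≠ 3 → a ≠ b → c ≠ d →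
    a = 2 ∧ b = 3 ∧ c = 0 ∧ d = 1 := by decide +kernel

lemma row1_aux : ∀ a b c d : Fin 4, a ≠ 0 → a ≠ 2 → b ≠ 1 → b ≠ 3 → c ≠ 0 → c ≠ 2 →
    d ≠ 1 → d ≠ 3 → a ≠ c → b ≠ d →
    ∃ k, a = sqT k 1 0 ∧ b = sqT k 1 1 ∧ c = sqT k 1 2 ∧ d = sqT k 1 3 := by decide +kernel

lemma row3_aux : ∀ k j x : Fin 4, x ≠ sqT k 0 j → x ≠ sqT k 1 j → x ≠ sqT k 2 j →
    x = sqT k 3 j := by decide +kernel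

lemma sqT_two : ∀ k, sqT k 2 = ![2,3,0,1] := by decide

lemma sq_classify (S : Fin 4 → Fin 4 → Fin 4)
    (hr : ∀ i j j', j ≠ j' → S i j ≠ S i j')
    (hc : ∀ j i i', i ≠ i' → S i j ≠ S i' j)
    (hk : ∀ i j i' j', knightAdj 4 (i, j) (i', j') → S i j ≠ S i' j')
    (h0 : ∀ j, S 0 j = j) : ∃ k, S = sqT k := by
  have c2 : ∀ i j, i ≠ 0 → S i j ≠ j := fun i j h => by
    have := hc j i 0 h
    rwa [h0] at this
  have k0 : ∀ i j j', knightAdj 4 (i, j) (0, j') → S i j ≠ j' := fun i j j' h => by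
    have := hk i j 0 j' h
    rwa [h0] at this
  obtain ⟨a0, a1, a2, a3⟩ := row2_aux (S 2 0) (S 2 1) (S 2 2) (S 2 3)
    (c2 2 0 (by decide)) (k0 2 0 1 (by decide)) (k0 2 1 0 (by decide)) (c2 2 1 (by decide))
    (k0 2 1 2 (by decide)) (k0 2 2 1 (by decide)) (c2 2 2 (by decide)) (k0 2 2 3 (by decide))
    (k0 2 3 2 (by decide)) (c2 2 3 (by decide)) (hr 2 0 1 (by decide)) (hr 2 2 3 (by decide))
  obtain ⟨k, b0, b1, b2, b3⟩ := row1_aux (S 1 0) (S 1 1) (S 1 2) (S 1 3)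
    (c2 1 0 (by decide)) (k0 1 0 2 (by decide)) (c2 1 1 (by decide)) (k0 1 1 3 (by decide))
    (k0 1 2 0 (by decide)) (c2 1 2 (by decide)) (k0 1 3 1 (by decide)) (c2 1 3 (by decide))
    (hr 1 0 2 (by decide)) (hr 1 1 3 (by decide))
  have r0 : ∀ j, S 0 j = sqT k 0 j := fun j => by rw [h0, sqT_zero]
  have r1 : ∀ j, S 1 j = sqT k 1 j := fun j => by fin_cases j <;> assumption
  have r2 : ∀ j, S 2 j = sqT k 2 j := fun j => by
    rw [sqT_two]; fin_cases j <;> assumption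
  have r3 : ∀ j, S 3 j = sqT k 3 j := fun j =>
    row3_aux k j _ (r0 j ▸ hc j 3 0 (by decide)) (r1 j ▸ hc j 3 1 (by decide))
      (r2 j ▸ hc j 3 2 (by decide))
  refine ⟨k, ?_⟩
  funext i j
  fin_cases i
  · exact r0 j
  · exact r1 j
  · exact r2 j
  · exact r3 j

/-- The square built from a relabelling and a normalized square. -/
def sqM (σ : Equiv.Perm (Fin 4)) (k : Fin 4) : Fin 4 → Fin 4 → ℕ :=
  fun i j => (σ (sqT k i j)).val + 1

lemma sqM_eq {σ τ : Equiv.Perm (Fin 4)} {k l i j i' j'} :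
    sqM σ k i j = sqM τ l i' j' ↔ σ (sqT k i j) = τ (sqT l i' j') := by
  simp [sqM, Fin.ext_iff]

lemma sqM_latin (σ k) : latin 4 (sqM σ k) := by
  refine ⟨fun i j => ?_, fun i j j' h => ?_, fun j i i' h => ?_⟩
  · have := (σ (sqT k i j)).isLt
    simp only [sqM, Finset.mem_Icc]; omega
  · exact sqT_row k i j j' (σ.injective (sqM_eq.1 h))
  · exact sqT_col k j i i' (σ.injective (sqM_eq.1 h))

lemma sqM_knight (σ k) (p q : Fin 4 × Fin 4) (h : knightAdj 4 p q) :
    sqM σ k p.1 p.2 ≠ sqM σ k q.1 q.2 :=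
  fun e => sqT_knight k p.1 p.2 q.1 q.2 h (σ.injective (sqM_eq.1 e))

lemma sqM_inj {σ τ k l} (h : sqM σ k = sqM τ l) : σ = τ ∧ k = l := by
  have e : ∀ i j, σ (sqT k i j) = τ (sqT l i j) := fun i j =>
    sqM_eq.1 (congrFun (congrFun h i) j)
  have h1 : σ = τ := by
    ext1 j
    simpa [sqT_zero] using e 0 j
  subst h1
  exact ⟨rfl, sqT_inj k l (σ.injective (e 1 0)) (σ.injective (e 1 1))⟩

lemma sqM_surj (M : Fin 4 → Fin 4 → ℕ) (hl : latin 4 M)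
    (hk : ∀ p q : Fin 4 × Fin 4, knightAdj 4 p q → M p.1 p.2 ≠ M q.1 q.2) :
    ∃ σ k, sqM σ k = M := by
  obtain ⟨hm, hr, hc⟩ := hl
  have : ∀ i j, ∃ x : Fin 4, x.val + 1 = M i j := fun i j => by
    have := Finset.mem_Icc.1 (hm i j)
    exact ⟨⟨M i j - 1, by omega⟩, by simp only; omega⟩
  choose N hN using this
  have hNM : ∀ {i j i' j'}, N i j = N i' j' → M i j = M i' j' := fun {i j i' j'} h => by
    rw [← hN, ← hN, h]
  have inj : Function.Injective (N 0) := fun j j' h => hr 0 (hNM h)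
  let σ : Equiv.Perm (Fin 4) := Equiv.ofBijective (N 0) (Finite.injective_iff_bijective.1 inj)
  obtain ⟨k, hS⟩ := sq_classify (fun i j => σ.symm (N i j))
    (fun i j j' h e => h (hr i (hNM (σ.symm.injective e))))
    (fun j i i' h e => h (hc j (hNM (σ.symm.injective e))))
    (fun i j i' j' h e => hk (i, j) (i', j') h (hNM (σ.symm.injective e)))
    (fun j => σ.symm_apply_apply j)
  refine ⟨σ, k, ?_⟩
  funext i j
  rw [sqM, ← hS, ← hN]
  simp

/-- There are exactly 4 anti-knight Latin squares of order 4 with first row `1,2,3,4`,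
and consequently 96 anti-knight Latin squares of order 4. -/
theorem stmt14 :
    Nat.card {M : Fin 4 → Fin 4 → ℕ // latin 4 M ∧
      (∀ p q : Fin 4 × Fin 4, knightAdj 4 p q → M p.1 p.2 ≠ M q.1 q.2) ∧
      ∀ j : Fin 4, M 0 j = j.val + 1} = 4 ∧
    Nat.card {M : Fin 4 → Fin 4 → ℕ // latin 4 M ∧
      ∀ p q : Fin 4 × Fin 4, knightAdj 4 p q → M p.1 p.2 ≠ M q.1 q.2} = 96 := by
  constructor
  · let f : Fin 4 → {M : Fin 4 → Fin 4 → ℕ // latin 4 M ∧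
      (∀ p q : Fin 4 × Fin 4, knightAdj 4 p q → M p.1 p.2 ≠ M q.1 q.2) ∧
      ∀ j : Fin 4, M 0 j = j.val + 1} := fun k =>
        ⟨sqM 1 k, sqM_latin 1 k, sqM_knight 1 k, fun j => by simp [sqM, sqT_zero]⟩
    have hf : Function.Bijective f := by
      refine ⟨fun k l h => (sqM_inj (congrArg Subtype.val h)).2, ?_⟩
      rintro ⟨M, hl, hk, h0⟩
      obtain ⟨σ, k, rfl⟩ := sqM_surj M hl hk
      have : σ = 1 := by
        ext j
        simpa [sqM, sqT_zero] using h0 j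
      subst this
      exact ⟨k, rfl⟩
    rw [← Nat.card_eq_of_bijective f hf]
    simp
  · let f : Equiv.Perm (Fin 4) × Fin 4 → {M : Fin 4 → Fin 4 → ℕ // latin 4 M ∧
      ∀ p q : Fin 4 × Fin 4, knightAdj 4 p q → M p.1 p.2 ≠ M q.1 q.2} := fun x =>
        ⟨sqM x.1 x.2, sqM_latin x.1 x.2, sqM_knight x.1 x.2⟩
    have hf : Function.Bijective f := by
      refine ⟨fun x y h => Prod.ext_iff.2 (sqM_inj (congrArg Subtype.val h)), ?_⟩
      rintro ⟨M, hl, hk⟩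
      obtain ⟨σ, k, rfl⟩ := sqM_surj M hl hk
      exact ⟨(σ, k), rfl⟩
    rw [← Nat.card_eq_of_bijective f hf, Nat.card_eq_fintype_card, Fintype.card_prod,
      Fintype.card_perm, Fintype.card_fin]
    rfl
end
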